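/- arXiv:2106.14614 — 2 statements merged into one kernel-verified Lean document; each statement's English description precedes it below -/
import Mathlib

section
/- Let μ₁, μ₂ ∈ ℝ and σ₁, σ₂ ≥ 0. Let π be a probability measure on ℝ × ℝ whose first marginal (pushforward under the first projection) is the Gaussian measure N(μ₁, σ₁²) on ℝ and whose second marginal is the Gaussian measure N(μ₂, σ₂²) on ℝ. Then ∫ (x − y)² dπ(x, y) ≥ (μ₁ − μ₂)² + (σ₁ − σ₂)². -/
open MeasureTheory ProbabilityTheory

/-- **Coupling lower bound for one-dimensional Gaussians** (following Eq. (15)):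
for any coupling `π` of `N(μ₁, σ₁²)` and `N(μ₂, σ₂²)`,
`∫ (x − y)² dπ ≥ (μ₁ − μ₂)² + (σ₁ − σ₂)²`. -/
theorem gaussian_coupling_lower_bound
    (μ₁ μ₂ σ₁ σ₂ : ℝ) (hσ₁ : 0 ≤ σ₁) (hσ₂ : 0 ≤ σ₂)
    (π : Measure (ℝ × ℝ)) [IsProbabilityMeasure π]
    (h₁ : π.map Prod.fst = gaussianReal μ₁ ⟨σ₁ ^ 2, sq_nonneg σ₁⟩)
    (h₂ : π.map Prod.snd = gaussianReal μ₂ ⟨σ₂ ^ 2, sq_nonneg σ₂⟩) :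
    (μ₁ - μ₂) ^ 2 + (σ₁ - σ₂) ^ 2 ≤ ∫ xy : ℝ × ℝ, (xy.1 - xy.2) ^ 2 ∂π := by
  have key : ∀ (m s : ℝ) (f : ℝ × ℝ → ℝ), Measurable f →
      π.map f = gaussianReal m ⟨s ^ 2, sq_nonneg s⟩ →
      MemLp f 2 π ∧ (∫ x, f x ∂π) = m ∧ (∫ x, f x ^ 2 ∂π) = m ^ 2 + s ^ 2 := by
    intro m s f hf h
    have hL : MemLp f 2 π := by
      have := memLp_id_gaussianReal' (μ := m) (v := ⟨s ^ 2, sq_nonneg s⟩) 2 (by simp)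
      rw [← h] at this
      exact this.comp_of_map hf.aemeasurable
    have hm : (∫ x, f x ∂π) = m := by
      have := integral_id_gaussianReal (μ := m) (v := ⟨s ^ 2, sq_nonneg s⟩)
      rw [← h, integral_map hf.aemeasurable (by fun_prop)] at this
      exact this
    have hv : Var[f; π] = s ^ 2 := by
      have := variance_id_gaussianReal (μ := m) (v := ⟨s ^ 2, sq_nonneg s⟩)
      rw [← h, variance_map (by fun_prop) hf.aemeasurable] at this
      exact this
    refine ⟨hL, hm, ?_⟩
    rw [variance_eq_sub hL, hm] at hv
    simp only [Pi.pow_apply] at hv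
    linarith
  obtain ⟨hX, mX, sX⟩ := key _ _ _ measurable_fst h₁
  obtain ⟨hY, mY, sY⟩ := key _ _ _ measurable_snd h₂
  have iX := hX.integrable_sq
  have iY := hY.integrable_sq
  have iXY : Integrable (fun x : ℝ × ℝ => x.1 * x.2) π := hX.integrable_mul hY
  have jX := hX.integrable (by norm_num)
  have jY := hY.integrable (by norm_num)
  set c := ∫ x : ℝ × ℝ, x.1 * x.2 ∂π with hc
  -- general quadratic expansion
  have ex : ∀ t d : ℝ, (∫ x : ℝ × ℝ, (x.1 - t * x.2 - d) ^ 2 ∂π) =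
      (μ₁ ^ 2 + σ₁ ^ 2) + t ^ 2 * (μ₂ ^ 2 + σ₂ ^ 2) - 2 * t * c - 2 * d * μ₁
        + 2 * t * d * μ₂ + d ^ 2 := by
    intro t d
    have : (fun x : ℝ × ℝ => (x.1 - t * x.2 - d) ^ 2) = fun x : ℝ × ℝ =>
        x.1 ^ 2 + t ^ 2 * x.2 ^ 2 - 2 * t * (x.1 * x.2) - 2 * d * x.1
          + 2 * t * d * x.2 + d ^ 2 := by
      funext x; ring
    rw [this, integral_add (by fun_prop) (by fun_prop), integral_add (by fun_prop) (by fun_prop),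
      integral_sub (by fun_prop) (by fun_prop), integral_sub (by fun_prop) (by fun_prop),
      integral_add (by fun_prop) (by fun_prop)]
    simp only [integral_const_mul, sX, sY, mX, mY, ← hc]
    simp
  have hd : discrim (σ₂ ^ 2) (-2 * (c - μ₁ * μ₂)) (σ₁ ^ 2) ≤ 0 := by
    apply discrim_le_zero
    intro t
    have h := ex t (μ₁ - t * μ₂)
    have h0 : 0 ≤ ∫ x : ℝ × ℝ, (x.1 - t * x.2 - (μ₁ - t * μ₂)) ^ 2 ∂π :=
      integral_nonneg fun x => sq_nonneg _
    rw [h] at h0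
    nlinarith [h0]
  have hcs : c - μ₁ * μ₂ ≤ σ₁ * σ₂ := by
    apply le_of_abs_le
    apply abs_le_of_sq_le_sq _ (by positivity)
    unfold discrim at hd
    nlinarith [hd]
  have e := ex 1 0
  simp only [one_mul, sub_zero] at e
  rw [e]
  nlinarith [hcs]
end

section
/- Let d ≥ 1, let μ₁, μ₂ : Fin d → ℝ, and let σ₁, σ₂ ≥ 0. Let P₁ be the product measure on (Fin d → ℝ) whose i-th factor is the Gaussian measure N(μ₁(i), σ₁²) on ℝ, and let P₂ be the product measure whose i-th factor is N(μ₂(i), σ₂²) (these are the isotropic Gaussian distributions N(μ₁, σ₁² I) and N(μ₂, σ₂² I)). Then for every probability measure π on (Fin d → ℝ) × (Fin d → ℝ) whose first marginal is P₁ and whose second marginal is P₂, ∫ Σ_{i=0}^{d−1} (x(i) − y(i))² dπ(x, y) ≥ Σ_{i=0}^{d−1} (μ₁(i) − μ₂(i))² + d · (σ₁ − σ₂)². -/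
open MeasureTheory ProbabilityTheory

lemma coupling_aux {Ω : Type*} [MeasurableSpace Ω] (P : Measure Ω) [IsProbabilityMeasure P]
    (X Y : Ω → ℝ) (a b s t : ℝ) (hs : 0 ≤ s) (ht : 0 ≤ t) (hX : MemLp X 2 P) (hY : MemLp Y 2 P)
    (eX : ∫ x, X x ∂P = a) (eY : ∫ x, Y x ∂P = b)
    (vX : variance X P = s ^ 2) (vY : variance Y P = t ^ 2) :
    (a - b) ^ 2 + (s - t) ^ 2 ≤ ∫ x, (X x - Y x) ^ 2 ∂P := by
  have hc : covariance X Y P ^ 2 ≤ (s * t) ^ 2 := by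
    have h : ∀ r : ℝ, 0 ≤ s ^ 2 * (r * r) + (2 * covariance X Y P) * r + t ^ 2 := by
      intro r
      have h0 := variance_nonneg (r • X + Y) P
      rw [variance_add (hX.const_smul r) hY, variance_smul, covariance_smul_left, vX, vY] at h0
      linarith
    have := discrim_le_zero h
    unfold discrim at this
    nlinarith
  have hc' : covariance X Y P ≤ s * t := le_of_sq_le_sq hc (mul_nonneg hs ht)
  have h1 := variance_sub hX hY
  rw [vX, vY, variance_eq_sub (hX.sub hY)] at h1
  have h2 : ∫ x, (X - Y) x ∂P = a - b := by
    rw [← eX, ← eY]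
    exact integral_sub (hX.integrable (by norm_num)) (hY.integrable (by norm_num))
  rw [h2] at h1
  have h3 : ∫ x, ((X - Y) ^ 2) x ∂P = ∫ x, (X x - Y x) ^ 2 ∂P := rfl
  rw [h3] at h1
  nlinarith

lemma marginal_aux {Ω : Type*} [MeasurableSpace Ω] (P : Measure Ω) (X : Ω → ℝ)
    (hX : Measurable X) (m s : ℝ) (h : P.map X = gaussianReal m ⟨s ^ 2, sq_nonneg s⟩) :
    MemLp X 2 P ∧ ∫ x, X x ∂P = m ∧ variance X P = s ^ 2 := by
  refine ⟨?_, ?_, ?_⟩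
  · have := memLp_id_gaussianReal' (μ := m) (v := ⟨s ^ 2, sq_nonneg s⟩) 2 (by norm_num)
    rw [← h] at this
    exact this.comp_of_map hX.aemeasurable
  · have := integral_id_gaussianReal (μ := m) (v := ⟨s ^ 2, sq_nonneg s⟩)
    rw [← h, integral_map hX.aemeasurable (by fun_prop)] at this
    exact this
  · have := variance_id_gaussianReal (μ := m) (v := ⟨s ^ 2, sq_nonneg s⟩)
    rw [← h, variance_map (by fun_prop) hX.aemeasurable] at this
    exact this


lemma eval_aux {Ω : Type*} [MeasurableSpace Ω] (P : Measure Ω) {d : ℕ} (m : Fin d → ℝ)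
    (v : NNReal) (f : Ω → Fin d → ℝ) (hf : Measurable f)
    (h : P.map f = Measure.pi (fun i => gaussianReal (m i) v)) (i : Fin d) :
    P.map (fun x => f x i) = gaussianReal (m i) v := by
  rw [← (measurePreserving_eval (fun i : Fin d => gaussianReal (m i) v) i).map_eq, ← h,
    Measure.map_map (measurable_pi_apply i) hf]
  rfl

/-- **Coupling lower bound for isotropic Gaussians in dimension `d`** (following Eq. (15)):
for any coupling `π` of `N(μ₁, σ₁² I)` and `N(μ₂, σ₂² I)` on `ℝ^d` (taken as product
measures of one-dimensional Gaussians over the coordinates),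
`∫ ∑ᵢ (xᵢ − yᵢ)² dπ ≥ ∑ᵢ (μ₁ᵢ − μ₂ᵢ)² + d · (σ₁ − σ₂)²`. -/
theorem isotropic_gaussian_coupling_lower_bound
    (d : ℕ) (hd : 1 ≤ d) (μ₁ μ₂ : Fin d → ℝ) (σ₁ σ₂ : ℝ) (hσ₁ : 0 ≤ σ₁) (hσ₂ : 0 ≤ σ₂)
    (π : Measure ((Fin d → ℝ) × (Fin d → ℝ))) [IsProbabilityMeasure π]
    (h₁ : π.map Prod.fst
      = Measure.pi (fun i : Fin d => gaussianReal (μ₁ i) ⟨σ₁ ^ 2, sq_nonneg σ₁⟩))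
    (h₂ : π.map Prod.snd
      = Measure.pi (fun i : Fin d => gaussianReal (μ₂ i) ⟨σ₂ ^ 2, sq_nonneg σ₂⟩)) :
    (∑ i : Fin d, (μ₁ i - μ₂ i) ^ 2) + d * (σ₁ - σ₂) ^ 2
      ≤ ∫ xy : (Fin d → ℝ) × (Fin d → ℝ), ∑ i : Fin d, (xy.1 i - xy.2 i) ^ 2 ∂π := by
  have A := eval_aux π μ₁ _ Prod.fst measurable_fst h₁
  have B := eval_aux π μ₂ _ Prod.snd measurable_snd h₂
  have A' := fun i => marginal_aux π _ (by fun_prop) _ _ (A i)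
  have B' := fun i => marginal_aux π _ (by fun_prop) _ _ (B i)
  have hI : ∀ i : Fin d, Integrable
      (fun xy : (Fin d → ℝ) × (Fin d → ℝ) => (xy.1 i - xy.2 i) ^ 2) π :=
    fun i => ((A' i).1.sub (B' i).1).integrable_sq
  rw [integral_finsetSum _ (fun i _ => hI i)]
  have key := Finset.sum_le_sum (fun i (_ : i ∈ Finset.univ) =>
    coupling_aux π _ _ _ _ _ _ hσ₁ hσ₂ (A' i).1 (B' i).1 (A' i).2.1 (B' i).2.1
      (A' i).2.2 (B' i).2.2)
  simpa [Finset.sum_add_distrib] using key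
end
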